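/- arXiv:1310.3086 — 4 statements merged into one kernel-verified Lean document; each statement's English description precedes it below -/
import Mathlib

section
/- Let σ ∈ ℝ, a ∈ ℝ, and let f : [a,∞) → ℝ be continuously differentiable. Then for every x > a, the fractional substantial integral I_s^ν f(x) converges to f(x) as ν → 0⁺; that is, lim_{ν→0⁺} (1/Γ(ν)) ∫_a^x (x−τ)^(ν−1) e^{−σ(x−τ)} f(τ) dτ = f(x). -/
open MeasureTheory Filter Set

/-- The fractional substantial integral of order `ν` with lower terminal `a`:
`I_s^ν f(x) = (1/Γ(ν)) ∫_a^x (x−τ)^(ν−1) e^{−σ(x−τ)} f(τ) dτ`. -/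
noncomputable def Isub (σ a ν : ℝ) (f : ℝ → ℝ) : ℝ → ℝ :=
  fun x => (1 / Real.Gamma ν) * ∫ τ in a..x, (x - τ) ^ (ν - 1) * Real.exp (-σ * (x - τ)) * f τ

/-- The power `(x - τ) ^ r` is integrable up to the endpoint `x` when `-1 < r`. -/
lemma intervalIntegrable_sub_rpow (a x : ℝ) {r : ℝ} (hr : -1 < r) :
    IntervalIntegrable (fun τ => (x - τ) ^ r) volume a x := by
  have h := (intervalIntegral.intervalIntegrable_rpow' (a := x - a) (b := 0) hr).comp_sub_left x
  simpa using h

lemma integral_sub_rpow (a x : ℝ) {r : ℝ} (hr : -1 < r) :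
    ∫ τ in a..x, (x - τ) ^ r = (x - a) ^ (r + 1) / (r + 1) := by
  rw [intervalIntegral.integral_comp_sub_left (fun s => s ^ r) x, sub_self,
    integral_rpow (Or.inl hr), Real.zero_rpow (by linarith), sub_zero]

/-- If `h τ = h x + (τ - x) * D τ` with `D` continuous, the Riemann–Liouville integrals of `h`
at `x` tend to `h x` as the order tends to zero. -/
lemma tendsto_riemannLiouville_of_slope {a x : ℝ} (hax : a < x) {h D : ℝ → ℝ}
    (hD : ContinuousOn D (Icc a x)) (hh : ∀ τ ∈ Icc a x, h τ = h x + (τ - x) * D τ) :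
    Tendsto (fun ν => (1 / Real.Gamma ν) * ∫ τ in a..x, (x - τ) ^ (ν - 1) * h τ)
      (nhdsWithin 0 (Ioi 0)) (nhds (h x)) := by
  obtain ⟨C, hC⟩ := isCompact_Icc.exists_bound_of_continuousOn hD
  have hT : 0 < x - a := sub_pos.2 hax
  have hΓ : ContinuousAt (fun ν : ℝ => Real.Gamma (ν + 1)) 0 := by
    have h1 : ContinuousAt Real.Gamma (0 + 1) :=
      Real.differentiableOn_Gamma_Ioi.continuousOn.continuousAt (Ioi_mem_nhds (by norm_num))
    exact h1.comp (f := fun ν : ℝ => ν + 1) (by fun_prop)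
  have hΓ0 : Real.Gamma (0 + 1) ≠ 0 := by simp
  have hmain : Tendsto (fun ν : ℝ => h x * ((x - a) ^ ν / Real.Gamma (ν + 1)))
      (nhdsWithin 0 (Ioi 0)) (nhds (h x)) := by
    have hc : ContinuousAt (fun ν : ℝ => h x * ((x - a) ^ ν / Real.Gamma (ν + 1))) 0 :=
      continuousAt_const.mul
        (((Real.continuous_const_rpow hT.ne').continuousAt).div hΓ hΓ0)
    have := hc.tendsto.mono_left (nhdsWithin_le_nhds (s := Ioi 0))
    simpa using this
  have hbound : Tendsto
      (fun ν : ℝ => ν / Real.Gamma (ν + 1) * (C * ((x - a) ^ (ν + 1) / (ν + 1))))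
      (nhdsWithin 0 (Ioi 0)) (nhds 0) := by
    have hp : ContinuousAt (fun ν : ℝ => (x - a) ^ (ν + 1)) 0 :=
      ((Real.continuous_const_rpow hT.ne').comp (continuous_add_const 1)).continuousAt
    have hc : ContinuousAt
        (fun ν : ℝ => ν / Real.Gamma (ν + 1) * (C * ((x - a) ^ (ν + 1) / (ν + 1)))) 0 :=
      (continuousAt_id.div hΓ hΓ0).mul
        (continuousAt_const.mul (hp.div (by fun_prop) (by norm_num)))
    have := hc.tendsto.mono_left (nhdsWithin_le_nhds (s := Ioi 0))
    simpa using this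
  have herr : Tendsto
      (fun ν : ℝ => ν / Real.Gamma (ν + 1) * ∫ τ in a..x, (x - τ) ^ ν * D τ)
      (nhdsWithin 0 (Ioi 0)) (nhds 0) := by
    refine squeeze_zero_norm' ?_ hbound
    filter_upwards [self_mem_nhdsWithin] with ν hν
    have hν : 0 < ν := hν
    have hpos : 0 < ν / Real.Gamma (ν + 1) := div_pos hν (Real.Gamma_pos_of_pos (by linarith))
    rw [norm_mul, Real.norm_of_nonneg hpos.le]
    gcongr
    rw [← integral_sub_rpow a x (by linarith : -1 < ν), ← intervalIntegral.integral_const_mul]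
    refine intervalIntegral.norm_integral_le_of_norm_le hax.le ?_
      ((intervalIntegrable_sub_rpow a x (by linarith)).const_mul C)
    refine Eventually.of_forall fun τ hτ => ?_
    have hnn : 0 ≤ (x - τ) ^ ν := Real.rpow_nonneg (sub_nonneg.2 hτ.2) ν
    rw [norm_mul, Real.norm_of_nonneg hnn, mul_comm]
    exact mul_le_mul_of_nonneg_right (hC τ (Ioc_subset_Icc_self hτ)) hnn
  have hdiff := hmain.sub herr
  rw [sub_zero] at hdiff
  refine hdiff.congr' ?_
  filter_upwards [self_mem_nhdsWithin] with ν hν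
  have hν : 0 < ν := hν
  have hsplit : ∫ τ in a..x, (x - τ) ^ (ν - 1) * h τ =
      ∫ τ in a..x, ((x - τ) ^ (ν - 1) * h x - (x - τ) ^ ν * D τ) := by
    refine intervalIntegral.integral_congr fun τ hτ => ?_
    rw [uIcc_of_le hax.le] at hτ
    rcases hτ.2.eq_or_lt with rfl | hlt
    · simp [Real.zero_rpow hν.ne']
    · have hx : 0 < x - τ := sub_pos.2 hlt
      have hpow : (x - τ) ^ ν = (x - τ) ^ (ν - 1) * (x - τ) := by
        rw [← Real.rpow_add_one hx.ne', sub_add_cancel]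
      simp only [hh τ hτ, hpow]
      ring
  have hint : IntervalIntegrable (fun τ => (x - τ) ^ ν * D τ) volume a x := by
    refine (intervalIntegrable_sub_rpow a x (by linarith)).mul_continuousOn ?_
    rwa [uIcc_of_le hax.le]
  rw [hsplit, intervalIntegral.integral_sub
    ((intervalIntegrable_sub_rpow a x (by linarith)).mul_const _) hint,
    intervalIntegral.integral_mul_const, integral_sub_rpow a x (by linarith), sub_add_cancel,
    Real.Gamma_add_one hν.ne']
  have := (Real.Gamma_pos_of_pos hν).ne'
  field_simp

/-- Lemma 2.1: for continuously differentiable `f` on `[a,∞)`, `I_s^ν f(x) → f(x)` as `ν → 0⁺`. -/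
theorem substantial_integral_tendsto_of_order_tendsto_zero
    (σ a : ℝ) (f : ℝ → ℝ) (hf : ContDiffOn ℝ 1 f (Set.Ici a)) :
    ∀ x > a, Tendsto (fun ν => Isub σ a ν f x) (nhdsWithin 0 (Set.Ioi 0)) (nhds (f x)) := by
  intro x hx
  have hxI : Ici a ∈ nhds x := Ici_mem_nhds hx
  set h : ℝ → ℝ := fun τ => Real.exp (-σ * (x - τ)) * f τ with hdef
  have hcont : ContinuousOn h (Ici a) := (by fun_prop : Continuous fun τ : ℝ =>
    Real.exp (-σ * (x - τ))).continuousOn.mul hf.continuousOn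
  have hdiff : DifferentiableAt ℝ h x := by
    have := (hf.contDiffAt hxI).differentiableAt one_ne_zero
    fun_prop
  have hD : ContinuousOn (dslope h x) (Icc a x) :=
    ((continuousOn_dslope hxI).2 ⟨hcont, hdiff⟩).mono Icc_subset_Ici_self
  have key := tendsto_riemannLiouville_of_slope (h := h) hx hD fun τ _ => by
    have := sub_smul_dslope h x τ
    rw [smul_eq_mul] at this
    linarith
  simpa [Isub, hdef, mul_assoc] using key
end

section
/- Let σ ∈ ℝ, a ∈ ℝ, μ, ν > 0, and let f : [a,∞) → ℝ be continuous. Then for all x ≥ a, the fractional substantial integrals satisfy the semigroup property I_s^ν[I_s^μ f](x) = I_s^{μ+ν} f(x) = I_s^μ[I_s^ν f](x). -/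
open MeasureTheory Set

/-- The integrand kernel `u ^ (ν - 1) * exp (-σ u)` truncated to `[0, L]`. -/
noncomputable def truncatedKernel (σ ν L : ℝ) : ℝ → ℝ :=
  indicator (Icc 0 L) fun u => u ^ (ν - 1) * Real.exp (-σ * u)

lemma integrable_truncatedKernel (σ : ℝ) {ν L : ℝ} (hν : 0 < ν) (hL : 0 ≤ L) :
    Integrable (truncatedKernel σ ν L) := by
  rw [truncatedKernel, integrable_indicator_iff measurableSet_Icc,
    ← intervalIntegrable_iff_integrableOn_Icc_of_le hL]
  exact (intervalIntegral.intervalIntegrable_rpow' (by linarith)).mul_continuousOn (by fun_prop)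

/-- The real Beta integral over `[0, c]`. -/
lemma integral_rpow_mul_sub_rpow {μ ν c : ℝ} (hμ : 0 < μ) (hν : 0 < ν) (hc : 0 < c) :
    ∫ u in 0..c, u ^ (μ - 1) * (c - u) ^ (ν - 1) =
      c ^ (μ + ν - 1) * ProbabilityTheory.beta μ ν := by
  have h := Complex.betaIntegral_scaled μ ν hc
  have h_left : ∫ u in 0..c, (u : ℂ) ^ ((μ : ℂ) - 1) * ((c : ℂ) - u) ^ ((ν : ℂ) - 1) =
      ((∫ u in 0..c, u ^ (μ - 1) * (c - u) ^ (ν - 1) : ℝ) : ℂ) := by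
    rw [← intervalIntegral.integral_ofReal]
    refine intervalIntegral.integral_congr fun u hu => ?_
    rw [uIcc_of_le hc.le] at hu
    rw [Complex.ofReal_mul, Complex.ofReal_cpow hu.1, Complex.ofReal_cpow (sub_nonneg.2 hu.2)]
    push_cast
    rfl
  have h_pow : (c : ℂ) ^ ((μ : ℂ) + ν - 1) = ((c ^ (μ + ν - 1) : ℝ) : ℂ) := by
    rw [Complex.ofReal_cpow hc.le]
    push_cast
    rfl
  rw [h_left, h_pow] at h
  rw [ProbabilityTheory.beta_eq_betaIntegralReal μ ν hμ hν, ← Complex.re_ofReal_mul, ← h,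
    Complex.ofReal_re]

lemma integral_truncatedKernel_mul_truncatedKernel (σ : ℝ) {a x s μ ν : ℝ} (hμ : 0 < μ)
    (hν : 0 < ν) (has : a < s) (hsx : s < x) :
    ∫ t, truncatedKernel σ ν (x - a) (x - t) * truncatedKernel σ μ (x - a) (t - s) =
      (x - s) ^ (μ + ν - 1) * Real.exp (-σ * (x - s)) * ProbabilityTheory.beta μ ν := by
  have h_ind : (fun t => truncatedKernel σ ν (x - a) (x - t) * truncatedKernel σ μ (x - a) (t - s))
      = indicator (Icc s x) fun t => Real.exp (-σ * (x - s)) *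
        ((t - s) ^ (μ - 1) * (x - s - (t - s)) ^ (ν - 1)) := by
    ext t
    by_cases ht : t ∈ Icc s x
    · have h₁ : x - t ∈ Icc 0 (x - a) := ⟨by linarith [ht.2], by linarith [ht.1]⟩
      have h₂ : t - s ∈ Icc 0 (x - a) := ⟨by linarith [ht.1], by linarith [ht.2]⟩
      rw [truncatedKernel, truncatedKernel, indicator_of_mem h₁, indicator_of_mem h₂,
        indicator_of_mem ht, sub_sub_sub_cancel_right,
        show -σ * (x - s) = -σ * (x - t) + -σ * (t - s) by ring, Real.exp_add]
      ring
    · rw [indicator_of_notMem ht, truncatedKernel, truncatedKernel]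
      by_cases h : s ≤ t
      · have h₁ : x - t ∉ Icc 0 (x - a) := fun h' => ht ⟨h, by linarith [h'.1]⟩
        rw [indicator_of_notMem h₁, zero_mul]
      · have h₂ : t - s ∉ Icc 0 (x - a) := fun h' => h (by linarith [h'.1])
        rw [indicator_of_notMem h₂, mul_zero]
  rw [h_ind, integral_indicator measurableSet_Icc, integral_Icc_eq_integral_Ioc,
    ← intervalIntegral.integral_of_le hsx.le, intervalIntegral.integral_const_mul,
    intervalIntegral.integral_comp_sub_right (fun u => u ^ (μ - 1) * (x - s - u) ^ (ν - 1)) s,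
    sub_self, integral_rpow_mul_sub_rpow hμ hν (sub_pos.2 hsx)]
  ring

lemma Isub_eq_integral_truncatedKernel (σ ν : ℝ) {a x t : ℝ} (f : ℝ → ℝ) (hat : a ≤ t)
    (htx : t ≤ x) :
    Isub σ a ν f t =
      1 / Real.Gamma ν * ∫ s, truncatedKernel σ ν (x - a) (t - s) * indicator (Ioc a x) f s := by
  rw [Isub, intervalIntegral.integral_of_le hat, ← integral_indicator measurableSet_Ioc]
  congr 2
  ext s
  by_cases hs : s ∈ Ioc a t
  · have h₁ : t - s ∈ Icc 0 (x - a) := ⟨by linarith [hs.2], by linarith [hs.1]⟩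
    have h₂ : s ∈ Ioc a x := ⟨hs.1, hs.2.trans htx⟩
    rw [indicator_of_mem hs, truncatedKernel, indicator_of_mem h₁, indicator_of_mem h₂]
  · rw [indicator_of_notMem hs, truncatedKernel]
    by_cases h : a < s
    · have h₁ : t - s ∉ Icc 0 (x - a) := fun h' => hs ⟨h, by linarith [h'.1]⟩
      rw [indicator_of_notMem h₁, zero_mul]
    · have h₂ : s ∉ Ioc a x := fun h' => h h'.1
      rw [indicator_of_notMem h₂, mul_zero]

lemma integrable_truncatedKernel_prod (σ : ℝ) {a x μ ν : ℝ} (hμ : 0 < μ) (hν : 0 < ν)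
    (hax : a ≤ x) {f : ℝ → ℝ} (hf : ContinuousOn f (Icc a x)) :
    Integrable (Function.uncurry fun s t =>
      truncatedKernel σ ν (x - a) (x - t) * truncatedKernel σ μ (x - a) (t - s) *
        indicator (Ioc a x) f s) (volume.prod volume) := by
  have hL : 0 ≤ x - a := sub_nonneg.2 hax
  have h_kernel := Integrable.convolution_integrand (ContinuousLinearMap.mul ℝ ℝ)
    ((integrable_truncatedKernel σ hν hL).comp_sub_left x)
    (integrable_truncatedKernel σ hμ hL).comp_neg
  simp only [ContinuousLinearMap.mul_apply', neg_sub] at h_kernel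
  obtain ⟨M, hM⟩ := isCompact_Icc.exists_bound_of_continuousOn hf
  have h_meas : AEStronglyMeasurable (indicator (Ioc a x) f) volume :=
    (aestronglyMeasurable_indicator_iff measurableSet_Ioc).2
      ((hf.mono Ioc_subset_Icc_self).aestronglyMeasurable measurableSet_Ioc)
  refine h_kernel.mul_bdd (c := M) h_meas.comp_fst (Filter.Eventually.of_forall fun p => ?_)
  by_cases hp : p.1 ∈ Ioc a x
  · simpa [indicator_of_mem hp] using hM _ (Ioc_subset_Icc_self hp)
  · rw [indicator_of_notMem hp, norm_zero]
    exact (norm_nonneg _).trans (hM a (left_mem_Icc.2 hax))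

lemma Isub_Isub (σ : ℝ) {a x μ ν : ℝ} (hμ : 0 < μ) (hν : 0 < ν) (hax : a ≤ x) {f : ℝ → ℝ}
    (hf : ContinuousOn f (Icc a x)) :
    Isub σ a ν (Isub σ a μ f) x = Isub σ a (μ + ν) f x := by
  have h_inner : ∀ t, truncatedKernel σ ν (x - a) (x - t) * indicator (Ioc a x) (Isub σ a μ f) t =
      1 / Real.Gamma μ * ∫ s, truncatedKernel σ ν (x - a) (x - t) *
        truncatedKernel σ μ (x - a) (t - s) * indicator (Ioc a x) f s := by
    intro t
    simp_rw [mul_assoc]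
    rw [integral_const_mul, mul_left_comm]
    by_cases ht : t ∈ Icc a x
    · rw [← Isub_eq_integral_truncatedKernel σ μ f ht.1 ht.2]
      rcases ht.1.eq_or_lt with rfl | h
      · simp [Isub]
      · rw [indicator_of_mem (show t ∈ Ioc a x from ⟨h, ht.2⟩)]
    · have h₁ : x - t ∉ Icc 0 (x - a) :=
        fun h' => ht ⟨by linarith [h'.2], by linarith [h'.1]⟩
      rw [truncatedKernel, indicator_of_notMem h₁, zero_mul, zero_mul]
  have h_outer : ∀ᵐ s, (∫ t, truncatedKernel σ ν (x - a) (x - t) *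
        truncatedKernel σ μ (x - a) (t - s) * indicator (Ioc a x) f s) =
      ProbabilityTheory.beta μ ν *
        (truncatedKernel σ (μ + ν) (x - a) (x - s) * indicator (Ioc a x) f s) := by
    filter_upwards [compl_mem_ae_iff.2 (measure_singleton x)] with s hsx
    rw [integral_mul_const]
    by_cases hs : s ∈ Ioc a x
    · have h₁ : x - s ∈ Icc 0 (x - a) := ⟨by linarith [hs.2], by linarith [hs.1]⟩
      rw [integral_truncatedKernel_mul_truncatedKernel σ hμ hν hs.1 (lt_of_le_of_ne hs.2 hsx),
        truncatedKernel, indicator_of_mem h₁]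
      ring
    · simp [indicator_of_notMem hs]
  rw [Isub_eq_integral_truncatedKernel σ ν _ hax le_rfl,
    Isub_eq_integral_truncatedKernel σ (μ + ν) f hax le_rfl]
  simp_rw [h_inner]
  rw [integral_const_mul,
    ← integral_integral_swap (integrable_truncatedKernel_prod σ hμ hν hax hf),
    integral_congr_ae h_outer, integral_const_mul, ProbabilityTheory.beta]
  have hΓμ := (Real.Gamma_pos_of_pos hμ).ne'
  have hΓν := (Real.Gamma_pos_of_pos hν).ne'
  field_simp

/-- Lemma 2.2: semigroup property of fractional substantial integrals. -/
theorem substantial_integral_semigroup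
    (σ a μ ν : ℝ) (hμ : 0 < μ) (hν : 0 < ν) (f : ℝ → ℝ)
    (hf : ContinuousOn f (Set.Ici a)) :
    ∀ x ≥ a, Isub σ a ν (Isub σ a μ f) x = Isub σ a (μ + ν) f x ∧
      Isub σ a (μ + ν) f x = Isub σ a μ (Isub σ a ν f) x := by
  intro x hx
  have hf' : ContinuousOn f (Icc a x) := hf.mono Icc_subset_Ici_self
  refine ⟨Isub_Isub σ hμ hν hx hf', ?_⟩
  rw [add_comm μ ν, Isub_Isub σ hν hμ hx hf']
end

section
/- Let σ ∈ ℝ, a ∈ ℝ, ν > 0, and let f : [a,∞) → ℝ be continuously differentiable. Then for all x > a, I_s^{ν+1}[D_s f](x) = I_s^ν f(x) − (f(a)/Γ(ν+1)) (x−a)^ν e^{−σ(x−a)}. -/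
open MeasureTheory Set

/-- The substantial derivative operator `D_s f = f′ + σ f`. -/
noncomputable def Dsub (σ : ℝ) (f : ℝ → ℝ) : ℝ → ℝ := fun x => deriv f x + σ * f x

/-- A function that is `C¹` on `[a, ∞)` has interval integrable derivative, since `deriv f`
differs from the continuous one-sided derivative at most at the left endpoint. -/
lemma intervalIntegrable_deriv_of_contDiffOn_Ici {a x : ℝ} (hax : a ≤ x) {f : ℝ → ℝ}
    (hf : ContDiffOn ℝ 1 f (Ici a)) : IntervalIntegrable (deriv f) volume a x := by
  have hcont : ContinuousOn (derivWithin f (Ici a)) (uIcc a x) := by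
    rw [uIcc_of_le hax]
    exact (hf.continuousOn_derivWithin (uniqueDiffOn_Ici a) le_rfl).mono Icc_subset_Ici_self
  refine hcont.intervalIntegrable.congr fun τ hτ => ?_
  rw [uIoc_of_le hax] at hτ
  exact derivWithin_of_mem_nhds (Ici_mem_nhds hτ.1)

lemma hasDerivAt_const_sub_rpow {x τ : ℝ} (ν : ℝ) (hτ : τ < x) :
    HasDerivAt (fun τ => (x - τ) ^ ν) (-(ν * (x - τ) ^ (ν - 1))) τ := by
  convert ((hasDerivAt_id' τ).const_sub x).rpow_const (p := ν) (Or.inl (sub_pos.2 hτ).ne') using 1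
  ring

lemma hasDerivAt_exp_neg_mul_const_sub (σ x τ : ℝ) :
    HasDerivAt (fun τ => Real.exp (-σ * (x - τ))) (σ * Real.exp (-σ * (x - τ))) τ := by
  convert (((hasDerivAt_id' τ).const_sub x).const_mul (-σ)).exp using 1
  ring

lemma intervalIntegrable_const_sub_rpow {ν : ℝ} (hν : 0 < ν) (a x : ℝ) :
    IntervalIntegrable (fun τ => (x - τ) ^ (ν - 1)) volume a x := by
  have h := (intervalIntegral.intervalIntegrable_rpow' (a := x - a) (b := 0)
    (r := ν - 1) (by linarith)).comp_sub_left x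
  simpa using h

/-- Integration by parts against the substantial kernel. -/
lemma integral_substantial_kernel_mul_Dsub (σ : ℝ) {a x ν : ℝ} (hν : 0 < ν) (hax : a < x)
    {f : ℝ → ℝ} (hf : ContDiffOn ℝ 1 f (Ici a)) :
    ∫ τ in a..x, (x - τ) ^ ν * Real.exp (-σ * (x - τ)) * Dsub σ f τ =
      ν * (∫ τ in a..x, (x - τ) ^ (ν - 1) * Real.exp (-σ * (x - τ)) * f τ) -
        (x - a) ^ ν * Real.exp (-σ * (x - a)) * f a := by
  have hfc : ContinuousOn f (uIcc a x) := by
    rw [uIcc_of_le hax.le]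
    exact hf.continuousOn.mono Icc_subset_Ici_self
  have hu : ContinuousOn (fun τ => (x - τ) ^ ν) (uIcc a x) :=
    ((continuous_const.sub continuous_id).rpow_const fun _ => Or.inr hν.le).continuousOn
  have hE : ContinuousOn (fun τ => Real.exp (-σ * (x - τ))) (uIcc a x) := by fun_prop
  have hDsub : IntervalIntegrable (Dsub σ f) volume a x :=
    (intervalIntegrable_deriv_of_contDiffOn_Ici hax.le hf).add
      (hfc.intervalIntegrable.const_mul σ)
  have hparts := intervalIntegral.integral_mul_deriv_eq_deriv_mul_of_hasDerivAt
    (u := fun τ => (x - τ) ^ ν) (u' := fun τ => -(ν * (x - τ) ^ (ν - 1)))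
    (v := fun τ => Real.exp (-σ * (x - τ)) * f τ)
    (v' := fun τ => Real.exp (-σ * (x - τ)) * Dsub σ f τ)
    hu (hE.mul hfc)
    (fun τ hτ => by
      rw [max_eq_right hax.le] at hτ
      exact hasDerivAt_const_sub_rpow ν hτ.2)
    (fun τ hτ => by
      rw [min_eq_left hax.le] at hτ
      have hfd : HasDerivAt f (deriv f τ) τ :=
        ((hf.differentiableOn one_ne_zero).differentiableAt (Ici_mem_nhds hτ.1)).hasDerivAt
      refine ((hasDerivAt_exp_neg_mul_const_sub σ x τ).mul hfd).congr_deriv ?_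
      simp only [Dsub]
      ring)
    ((intervalIntegrable_const_sub_rpow hν a x).const_mul ν).neg
    (hDsub.continuousOn_mul hE)
  simp only [sub_self, Real.zero_rpow hν.ne', zero_mul, zero_sub, neg_mul,
    intervalIntegral.integral_neg, mul_assoc, intervalIntegral.integral_const_mul] at hparts ⊢
  rw [hparts]
  ring

/-- Lemma 2.5, Eq. (2.1):
`I_s^{ν+1}[D_s f](x) = I_s^ν f(x) − (f(a)/Γ(ν+1)) (x−a)^ν e^{−σ(x−a)}`. -/
theorem substantial_integral_of_derivative
    (σ a ν : ℝ) (hν : 0 < ν) (f : ℝ → ℝ) (hf : ContDiffOn ℝ 1 f (Set.Ici a)) :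
    ∀ x > a, Isub σ a (ν + 1) (Dsub σ f) x =
      Isub σ a ν f x - f a / Real.Gamma (ν + 1) * (x - a) ^ ν * Real.exp (-σ * (x - a)) := by
  intro x hx
  have hΓ : Real.Gamma ν ≠ 0 := (Real.Gamma_pos_of_pos hν).ne'
  simp only [Isub, add_sub_cancel_right]
  rw [integral_substantial_kernel_mul_Dsub σ hν hx hf, Real.Gamma_add_one hν.ne']
  generalize (∫ τ in a..x, (x - τ) ^ (ν - 1) * Real.exp (-σ * (x - τ)) * f τ) = J
  field_simp
end

section
/- Let σ > 0, let ν > 0 with m = ⌈ν⌉, and let f : ℝ → ℝ be m-times continuously differentiable with f, f′, …, f^{(m)} all in L¹(ℝ). Define 𝒟_s^ν f = D_s^m[ℐ_s^{m−ν} f], where D_s g = g′ + σg, D_s^m is its m-fold iterate, and ℐ_s^{m−ν} is the whole-line fractional substantial integral (ℐ_s^0 = identity). Then the Fourier transform of 𝒟_s^ν f satisfies ∫_ℝ e^{iωx} (𝒟_s^ν f)(x) dx = (σ−iω)^ν · f̂(ω) for every ω ∈ ℝ, where f̂(ω) = ∫_ℝ e^{iωx} f(x) dx and (σ−iω)^ν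 is the principal branch of the complex power. -/
open MeasureTheory Set

/-- The whole-line fractional substantial integral (`ℐ_s^0 = identity`). -/
noncomputable def Iws (σ ν : ℝ) (f : ℝ → ℝ) : ℝ → ℝ :=
  if ν = 0 then f else
    fun x => (1 / Real.Gamma ν) *
      ∫ τ in Set.Iic x, (x - τ) ^ (ν - 1) * Real.exp (-σ * (x - τ)) * f τ

/-- The whole-line fractional substantial derivative
`𝒟_s^ν f = D_s^m [ℐ_s^{m−ν} f]` with `m = ⌈ν⌉`. -/
noncomputable def Dws (σ ν : ℝ) (f : ℝ → ℝ) : ℝ → ℝ :=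
  (Dsub σ)^[⌈ν⌉₊] (Iws σ ((⌈ν⌉₊ : ℝ) - ν) f)

/-- The convolution kernel `t ↦ t^(μ-1) e^{-σ t}` on `t > 0`, extended by zero. -/
noncomputable def substKernel (σ μ : ℝ) : ℝ → ℝ :=
  (Ioi 0).indicator fun t => t ^ (μ - 1) * Real.exp (-σ * t)

theorem integrableOn_rpow_mul_exp {σ μ : ℝ} (hσ : 0 < σ) (hμ : 0 < μ) :
    IntegrableOn (fun t : ℝ => t ^ (μ - 1) * Real.exp (-σ * t)) (Ioi 0) := by
  simpa using integrableOn_rpow_mul_exp_neg_mul_rpow (s := μ - 1) (p := 1) (by linarith) one_pos hσ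

theorem integrable_substKernel {σ μ : ℝ} (hσ : 0 < σ) (hμ : 0 < μ) :
    Integrable (substKernel σ μ) :=
  (integrable_indicator_iff measurableSet_Ioi).2 (integrableOn_rpow_mul_exp hσ hμ)

theorem continuousAt_substKernel {σ μ t : ℝ} (ht : t ≠ 0) :
    ContinuousAt (substKernel σ μ) t := by
  rcases lt_or_gt_of_ne ht with h | h
  · refine (continuousAt_const (y := (0 : ℝ))).congr ?_
    filter_upwards [Iio_mem_nhds h] with s hs
    exact (indicator_of_notMem (notMem_Ioi.2 (le_of_lt hs)) _).symm
  · have : ContinuousAt (fun t : ℝ => t ^ (μ - 1) * Real.exp (-σ * t)) t :=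
      (Real.continuousAt_rpow_const t _ (Or.inl ht)).mul (by fun_prop)
    refine this.congr ?_
    filter_upwards [Ioi_mem_nhds h] with s hs
    exact (indicator_of_mem (mem_Ioi.2 hs)
      fun t : ℝ => t ^ (μ - 1) * Real.exp (-σ * t)).symm

theorem abs_substKernel_le_one {σ μ t : ℝ} (hσ : 0 < σ) (hμ : μ < 1) (ht : 1 ≤ t) :
    |substKernel σ μ t| ≤ 1 := by
  have h0 : (0 : ℝ) < t := by linarith
  rw [substKernel, indicator_of_mem (mem_Ioi.2 h0), abs_of_nonneg (by positivity)]
  exact mul_le_one₀ (Real.rpow_le_one_of_one_le_of_nonpos ht (by linarith)) (by positivity)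
    (Real.exp_le_one_iff.2 (by nlinarith))


/-- The part of the kernel near its singularity, times a continuous function, is dominated by
an integrable function, locally uniformly in the base point. -/
theorem exists_bound_substKernel_near (σ μ : ℝ) {g : ℝ → ℝ} (hg : Continuous g) (x₀ : ℝ) :
    ∃ C, ∀ x t, |x - x₀| ≤ 1 →
      |(Iio 1).indicator (substKernel σ μ) t * g (x - t)| ≤ C * |substKernel σ μ t| := by
  obtain ⟨C, hC⟩ := (isCompact_Icc (a := x₀ - 2) (b := x₀ + 1)).exists_bound_of_continuousOn
    hg.continuousOn
  have hC0 : 0 ≤ C := (norm_nonneg _).trans (hC x₀ ⟨by linarith, by linarith⟩)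
  refine ⟨C, fun x t hx => ?_⟩
  rw [abs_le] at hx
  by_cases h : t ∈ Iio (1 : ℝ)
  · rw [indicator_of_mem h, abs_mul, mul_comm]
    rcases le_or_gt t 0 with h' | h'
    · rw [substKernel, indicator_of_notMem (notMem_Ioi.2 h')]
      simp
    · have h1 : t < 1 := h
      exact mul_le_mul_of_nonneg_right (hC _ ⟨by linarith, by linarith⟩) (abs_nonneg _)
  · rw [indicator_of_notMem h]
    simp only [zero_mul, abs_zero]
    positivity

theorem abs_substKernel_far_mul_le {σ μ : ℝ} (hσ : 0 < σ) (hμ1 : μ < 1) (t y : ℝ) :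
    |(Ici 1).indicator (substKernel σ μ) t * y| ≤ |y| := by
  by_cases h : t ∈ Ici (1 : ℝ)
  · rw [indicator_of_mem h, abs_mul]
    exact mul_le_of_le_one_left (abs_nonneg _) (abs_substKernel_le_one hσ hμ1 h)
  · rw [indicator_of_notMem h]
    simp

theorem integrable_substKernel_near_mul {σ μ : ℝ} (hσ : 0 < σ) (hμ : 0 < μ)
    {g : ℝ → ℝ} (hg : Continuous g) (x : ℝ) :
    Integrable fun t => (Iio 1).indicator (substKernel σ μ) t * g (x - t) := by
  obtain ⟨C, hC⟩ := exists_bound_substKernel_near σ μ hg x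
  have hK := integrable_substKernel hσ hμ
  refine (hK.abs.const_mul C).mono'
    ((hK.indicator measurableSet_Iio).aestronglyMeasurable.mul
      (by fun_prop : Continuous fun t => g (x - t)).aestronglyMeasurable) (.of_forall fun t => ?_)
  exact hC x t (by simp)

theorem integrable_substKernel_far_mul {σ μ : ℝ} (hσ : 0 < σ) (hμ : 0 < μ) (hμ1 : μ < 1)
    {g : ℝ → ℝ} (hgi : Integrable g) (x : ℝ) :
    Integrable fun t => (Ici 1).indicator (substKernel σ μ) t * g (x - t) := by
  have hK := integrable_substKernel hσ hμ
  have hg' := hgi.comp_sub_left x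
  exact hg'.abs.mono' ((hK.indicator measurableSet_Ici).aestronglyMeasurable.mul
    hg'.aestronglyMeasurable) (.of_forall fun t => abs_substKernel_far_mul_le hσ hμ1 _ _)

theorem substKernel_near_add_far (σ μ t : ℝ) :
    (Iio 1).indicator (substKernel σ μ) t + (Ici 1).indicator (substKernel σ μ) t =
      substKernel σ μ t := by
  rw [← compl_Iio]
  exact congrFun (indicator_self_add_compl (Iio (1 : ℝ)) (substKernel σ μ)) t

theorem integrable_substKernel_mul {σ μ : ℝ} (hσ : 0 < σ) (hμ : 0 < μ) (hμ1 : μ < 1)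
    {g : ℝ → ℝ} (hg : Continuous g) (hgi : Integrable g) (x : ℝ) :
    Integrable fun t => substKernel σ μ t * g (x - t) := by
  refine ((integrable_substKernel_near_mul hσ hμ hg x).add
    (integrable_substKernel_far_mul hσ hμ hμ1 hgi x)).congr (.of_forall fun t => ?_)
  simp only [Pi.add_apply, ← add_mul, substKernel_near_add_far]

theorem continuous_integral_substKernel_mul {σ μ : ℝ} (hσ : 0 < σ) (hμ : 0 < μ) (hμ1 : μ < 1)
    {g : ℝ → ℝ} (hg : Continuous g) (hgi : Integrable g) :
    Continuous fun x => ∫ t, substKernel σ μ t * g (x - t) := by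
  have hK := integrable_substKernel hσ hμ
  have hsplit : ∀ x, ∫ t, substKernel σ μ t * g (x - t) =
      (∫ t, (Iio 1).indicator (substKernel σ μ) t * g (x - t)) +
        ∫ τ, (Ici 1).indicator (substKernel σ μ) (x - τ) * g τ := fun x => by
    have h := integral_sub_left_eq_self
      (fun t => (Ici 1).indicator (substKernel σ μ) t * g (x - t)) volume x
    simp only [sub_sub_cancel] at h
    rw [h, ← integral_add (integrable_substKernel_near_mul hσ hμ hg x)
      (integrable_substKernel_far_mul hσ hμ hμ1 hgi x)]
    simp only [← add_mul, substKernel_near_add_far]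
  simp only [hsplit]
  refine continuous_iff_continuousAt.2 fun x₀ => ContinuousAt.add ?_ ?_
  · obtain ⟨C, hC⟩ := exists_bound_substKernel_near σ μ hg x₀
    refine continuousAt_of_dominated (bound := fun t => C * |substKernel σ μ t|)
      (.of_forall fun x => (integrable_substKernel_near_mul hσ hμ hg x).aestronglyMeasurable)
      ?_ (hK.abs.const_mul C) (.of_forall fun t => by fun_prop)
    filter_upwards [Metric.closedBall_mem_nhds x₀ one_pos] with x hx
    exact .of_forall fun t => hC x t hx
  · refine continuousAt_of_dominated (bound := fun τ => |g τ|)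
      (.of_forall fun x => ?_)
      (.of_forall fun x => .of_forall fun τ => abs_substKernel_far_mul_le hσ hμ1 _ _) hgi.abs ?_
    · exact ((hK.indicator measurableSet_Ici).comp_sub_left x).aestronglyMeasurable.mul
        hgi.aestronglyMeasurable
    · filter_upwards [compl_mem_ae_iff.2 (measure_singleton (μ := volume) (x₀ - 1))] with τ hτ
      have hne : x₀ - τ ≠ 1 := fun h => hτ (by simp only [mem_singleton_iff]; linarith)
      have hc : ContinuousAt ((Ici 1).indicator (substKernel σ μ)) (x₀ - τ) := by
        rcases lt_or_gt_of_ne hne with h | h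
        · refine (continuousAt_const (y := (0 : ℝ))).congr ?_
          filter_upwards [Iio_mem_nhds h] with s hs
          exact (indicator_of_notMem (notMem_Ici.2 hs) _).symm
        · refine (continuousAt_substKernel (σ := σ) (μ := μ) (by linarith)).congr ?_
          filter_upwards [Ioi_mem_nhds h] with s hs
          exact (indicator_of_mem (mem_Ici.2 (le_of_lt hs)) _).symm
      exact (ContinuousAt.comp' (f := fun x => x - τ) hc (by fun_prop)).mul_const _

theorem hasDerivAt_integral_substKernel_mul {σ μ : ℝ} (hσ : 0 < σ) (hμ : 0 < μ) (hμ1 : μ < 1)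
    {f : ℝ → ℝ} (hf : ContDiff ℝ 1 f) (hfi : Integrable f) (hfi' : Integrable (deriv f)) (x : ℝ) :
    HasDerivAt (fun x => ∫ t, substKernel σ μ t * f (x - t))
      (∫ t, substKernel σ μ t * deriv f (x - t)) x := by
  have hf' : Continuous (deriv f) := hf.continuous_deriv le_rfl
  have hcont := continuous_integral_substKernel_mul hσ hμ hμ1 hf' hfi'
  have key : ∀ y, ∫ t, substKernel σ μ t * f (y - t) =
      (∫ s in 0..y, ∫ t, substKernel σ μ t * deriv f (s - t)) +
        ∫ t, substKernel σ μ t * f (0 - t) := fun y => by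
    have hftc : ∀ t, ∫ s in 0..y, deriv f (s - t) = f (y - t) - f (0 - t) := fun t =>
      intervalIntegral.integral_eq_sub_of_hasDerivAt (f := fun s => f (s - t))
        (fun s _ => (hf.differentiable one_ne_zero _).hasDerivAt.comp_sub_const s t)
        ((by fun_prop : Continuous fun s => deriv f (s - t)).intervalIntegrable _ _)
    rw [intervalIntegral_integral_swap, ← integral_add]
    · refine integral_congr_ae (.of_forall fun t => ?_)
      simp only [intervalIntegral.integral_const_mul, hftc]
      ring
    · refine ((integrable_substKernel_mul hσ hμ hμ1 hf.continuous hfi y).sub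
        (integrable_substKernel_mul hσ hμ hμ1 hf.continuous hfi 0)).congr (.of_forall fun t => ?_)
      simp only [intervalIntegral.integral_const_mul, hftc, Pi.sub_apply]
      ring
    · exact integrable_substKernel_mul hσ hμ hμ1 hf.continuous hfi 0
    · have h := (integrable_substKernel hσ hμ).convolution_integrand (μ := volume)
        (ContinuousLinearMap.mul ℝ ℝ) hfi'
      refine h.mono_measure ?_
      exact Measure.prod_mono Measure.restrict_le_self le_rfl
  rw [funext key]
  exact (hcont.integral_hasStrictDerivAt 0 x).hasDerivAt.add_const _

open ProbabilityTheory in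
theorem integral_rpow_mul_cexp_neg_mul_Ioi {a : ℝ} (ha : 0 < a) {z : ℂ} (hz : 0 < z.re) :
    ∫ t : ℝ in Ioi 0, ((t ^ (a - 1) : ℝ) : ℂ) * Complex.exp (-z * t) =
      z ^ (-(a : ℂ)) * (Real.Gamma a : ℂ) := by
  set κ : Measure ℝ := (volume.restrict (Ioi 0)).withDensity
    fun t => ENNReal.ofReal (t ^ (a - 1)) with hκ
  have hmeas : Measurable fun t : ℝ => ENNReal.ofReal (t ^ (a - 1)) := by fun_prop
  have hfin : ∀ᵐ t : ℝ ∂(volume.restrict (Ioi 0)), ENNReal.ofReal (t ^ (a - 1)) < ⊤ :=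
    .of_forall fun _ => ENNReal.ofReal_lt_top
  have hmgf : ∀ w : ℂ, complexMGF id κ w =
      ∫ t : ℝ in Ioi 0, ((t ^ (a - 1) : ℝ) : ℂ) * Complex.exp (w * t) := fun w => by
    rw [complexMGF, hκ, integral_withDensity_eq_integral_toReal_smul hmeas hfin]
    refine setIntegral_congr_fun measurableSet_Ioi fun t ht => ?_
    have ht : 0 < t := ht
    simp [ENNReal.toReal_ofReal (Real.rpow_nonneg ht.le _)]
  have hset : Iio 0 ⊆ integrableExpSet id κ := fun s hs => by
    have hs : 0 < -s := by simpa using hs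
    rw [integrableExpSet, mem_ofPred_eq, hκ,
      integrable_withDensity_iff_integrable_smul' hmeas hfin]
    have h := integrableOn_rpow_mul_exp_neg_mul_rpow (s := a - 1) (p := 1) (by linarith)
      one_pos hs
    refine h.congr_fun (fun t ht => ?_) measurableSet_Ioi
    have ht : 0 < t := ht
    simp [ENNReal.toReal_ofReal (Real.rpow_nonneg ht.le _)]
  have hF : AnalyticOnNhd ℂ (fun w => complexMGF id κ (-w)) {w | 0 < w.re} := fun w hw => by
    have : -w.re ∈ interior (integrableExpSet id κ) :=
      interior_mono hset (by rw [isOpen_Iio.interior_eq]; simpa using hw)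
    exact (analyticAt_complexMGF (z := -w) (by simpa using this)).fun_comp analyticAt_id.neg
  have hG : AnalyticOnNhd ℂ (fun w : ℂ => w ^ (-(a : ℂ)) * (Real.Gamma a : ℂ))
      {w | 0 < w.re} := fun w hw =>
    (analyticAt_id.cpow analyticAt_const (Or.inl hw)).mul analyticAt_const
  have hreal : ∀ r : ℝ, 0 < r →
      complexMGF id κ (-(r : ℂ)) = (r : ℂ) ^ (-(a : ℂ)) * (Real.Gamma a : ℂ) := fun r hr => by
    have h := Complex.integral_cpow_mul_exp_neg_mul_Ioi (a := a) (by simpa using ha) hr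
    rw [Complex.Gamma_ofReal, one_div, Complex.inv_cpow _ _ (by
      rw [Complex.arg_ofReal_of_nonneg hr.le]; exact Real.pi_pos.ne), ← Complex.cpow_neg] at h
    rw [hmgf, ← h]
    refine setIntegral_congr_fun measurableSet_Ioi fun t ht => ?_
    have ht : 0 < t := ht
    simp [Complex.ofReal_cpow ht.le]
  have hfreq : ∃ᶠ w : ℂ in nhdsWithin 1 {1}ᶜ, complexMGF id κ (-w) =
      w ^ (-(a : ℂ)) * (Real.Gamma a : ℂ) := by
    have htend : Filter.Tendsto (fun r : ℝ => (r : ℂ)) (nhdsWithin 1 {1}ᶜ)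
        (nhdsWithin 1 {1}ᶜ) := by
      refine tendsto_nhdsWithin_iff.2 ⟨?_, ?_⟩
      · exact (Complex.continuous_ofReal.tendsto' 1 1 (by simp)).mono_left nhdsWithin_le_nhds
      · filter_upwards [self_mem_nhdsWithin] with r hr
        simpa using hr
    refine htend.frequently (Filter.Eventually.frequently ?_)
    filter_upwards [mem_nhdsWithin_of_mem_nhds (Ioi_mem_nhds one_pos)] with r hr
    exact hreal r hr
  have := hF.eqOn_of_preconnected_of_frequently_eq hG
    (convex_halfSpace_re_gt 0).isPreconnected (z₀ := 1) (by simp) hfreq hz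
  rw [← hmgf]
  exact this

theorem Iws_eq_integral_substKernel (σ : ℝ) {μ : ℝ} (hμ : μ ≠ 0) (f : ℝ → ℝ) :
    Iws σ μ f = fun x => (1 / Real.Gamma μ) * ∫ t, substKernel σ μ t * f (x - t) := by
  funext x
  rw [Iws, if_neg hμ]
  congr 1
  have h := integral_sub_left_eq_self
    (fun t => substKernel σ μ t * f (x - t)) volume x
  simp only [sub_sub_cancel] at h
  rw [← h, integral_Iic_eq_integral_Iio, ← integral_indicator measurableSet_Iio]
  refine integral_congr_ae (.of_forall fun τ => ?_)
  by_cases hτ : τ < x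
  · simp [substKernel, hτ]
  · simp [substKernel, hτ]

theorem norm_cexp_ofReal_mul_ofReal_mul_I (ω x : ℝ) :
    ‖Complex.exp ((ω : ℂ) * (x : ℂ) * Complex.I)‖ = 1 := by
  rw [← Complex.ofReal_mul, Complex.norm_exp_ofReal_mul_I]

theorem integrable_cexp_mul_ofReal (ω : ℝ) {h : ℝ → ℝ} (hh : Integrable h) :
    Integrable fun x : ℝ => Complex.exp ((ω : ℂ) * (x : ℂ) * Complex.I) * (h x : ℂ) :=
  hh.ofReal.bdd_mul (c := 1) (by fun_prop : Continuous _).aestronglyMeasurable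
    (.of_forall fun x => (norm_cexp_ofReal_mul_ofReal_mul_I ω x).le)

theorem integral_cexp_mul_substKernel {σ μ : ℝ} (hσ : 0 < σ) (hμ : 0 < μ) (ω : ℝ) :
    ∫ t : ℝ, Complex.exp ((ω : ℂ) * (t : ℂ) * Complex.I) * (substKernel σ μ t : ℂ) =
      ((σ : ℂ) - (ω : ℂ) * Complex.I) ^ (-(μ : ℂ)) * (Real.Gamma μ : ℂ) := by
  rw [← integral_rpow_mul_cexp_neg_mul_Ioi hμ (by simpa using hσ),
    ← integral_indicator measurableSet_Ioi]
  refine integral_congr_ae (.of_forall fun t => ?_)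
  by_cases ht : 0 < t
  · simp only [substKernel, indicator_of_mem (mem_Ioi.2 ht), Complex.ofReal_mul,
      Complex.ofReal_exp]
    rw [mul_left_comm, ← Complex.exp_add]
    congr 2
    push_cast
    ring
  · simp [substKernel, ht]

theorem fourier_Iws {σ μ : ℝ} (hσ : 0 < σ) (hμ : 0 ≤ μ) {h : ℝ → ℝ} (hh : Integrable h) (ω : ℝ) :
    ∫ x : ℝ, Complex.exp ((ω : ℂ) * (x : ℂ) * Complex.I) * (Iws σ μ h x : ℂ) =
      ((σ : ℂ) - (ω : ℂ) * Complex.I) ^ (-(μ : ℂ)) *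
        ∫ x : ℝ, Complex.exp ((ω : ℂ) * (x : ℂ) * Complex.I) * (h x : ℂ) := by
  rcases hμ.eq_or_lt with rfl | hμ
  · simp [Iws]
  have hΓ : (Real.Gamma μ : ℂ) ≠ 0 := by exact_mod_cast (Real.Gamma_pos_of_pos hμ).ne'
  have hconv := integral_convolution (ContinuousLinearMap.mul ℂ ℂ)
    (integrable_cexp_mul_ofReal ω (integrable_substKernel hσ hμ))
    (integrable_cexp_mul_ofReal ω hh)
  rw [ContinuousLinearMap.mul_apply', integral_cexp_mul_substKernel hσ hμ] at hconv
  have hpt : ∀ x : ℝ, Complex.exp ((ω : ℂ) * (x : ℂ) * Complex.I) * (Iws σ μ h x : ℂ) =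
      (1 / (Real.Gamma μ : ℂ)) * convolution
        (fun t : ℝ => Complex.exp ((ω : ℂ) * (t : ℂ) * Complex.I) * (substKernel σ μ t : ℂ))
        (fun t : ℝ => Complex.exp ((ω : ℂ) * (t : ℂ) * Complex.I) * (h t : ℂ))
        (ContinuousLinearMap.mul ℂ ℂ) volume x := fun x => by
    rw [Iws_eq_integral_substKernel σ hμ.ne', convolution_def]
    push_cast
    rw [← integral_complex_ofReal, mul_left_comm, ← integral_const_mul]
    congr 1
    refine integral_congr_ae (.of_forall fun t => ?_)
    have : Complex.exp ((ω : ℂ) * (x : ℂ) * Complex.I) =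
        Complex.exp ((ω : ℂ) * (t : ℂ) * Complex.I) *
          Complex.exp ((ω : ℂ) * ((x - t : ℝ) : ℂ) * Complex.I) := by
      rw [← Complex.exp_add]
      congr 1
      push_cast
      ring
    simp only [ContinuousLinearMap.mul_apply', this, Complex.ofReal_mul]
    rw [mul_mul_mul_comm, Complex.ofReal_sub]
  simp only [hpt]
  rw [integral_const_mul, hconv]
  field_simp

theorem fourier_Dsub (σ ω : ℝ) {f : ℝ → ℝ} (hf : ContDiff ℝ 1 f) (hfi : Integrable f)
    (hfi' : Integrable (deriv f)) :
    ∫ x : ℝ, Complex.exp ((ω : ℂ) * (x : ℂ) * Complex.I) * (Dsub σ f x : ℂ) =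
      ((σ : ℂ) - (ω : ℂ) * Complex.I) *
        ∫ x : ℝ, Complex.exp ((ω : ℂ) * (x : ℂ) * Complex.I) * (f x : ℂ) := by
  have hE : ∀ x : ℝ, HasDerivAt (fun x : ℝ => Complex.exp ((ω : ℂ) * (x : ℂ) * Complex.I))
      ((ω : ℂ) * Complex.I * Complex.exp ((ω : ℂ) * (x : ℂ) * Complex.I)) x := fun x => by
    have := (((Complex.ofRealCLM.hasDerivAt (x := x)).const_mul (ω : ℂ)).mul_const
      Complex.I).cexp
    simpa [mul_comm] using this
  have hi := integrable_cexp_mul_ofReal ω hfi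
  have hi' := integrable_cexp_mul_ofReal ω hfi'
  have hparts := integral_mul_deriv_eq_deriv_mul_of_integrable
    (u := fun x : ℝ => Complex.exp ((ω : ℂ) * (x : ℂ) * Complex.I))
    (v := fun x : ℝ => (f x : ℂ)) (v' := fun x : ℝ => ((deriv f x : ℝ) : ℂ))
    (fun x _ => hE x)
    (fun x _ => (hf.differentiable one_ne_zero x).hasDerivAt.ofReal_comp) hi'
    ((hi.const_mul ((ω : ℂ) * Complex.I)).congr
      (.of_forall fun x => (mul_assoc _ _ _).symm)) hi
  have hsum : ∀ x : ℝ, Complex.exp ((ω : ℂ) * (x : ℂ) * Complex.I) * (Dsub σ f x : ℂ) =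
      Complex.exp ((ω : ℂ) * (x : ℂ) * Complex.I) * ((deriv f x : ℝ) : ℂ) +
        σ * (Complex.exp ((ω : ℂ) * (x : ℂ) * Complex.I) * (f x : ℂ)) := fun x => by
    simp only [Dsub]
    push_cast
    ring
  simp only [hsum]
  rw [integral_add hi' (hi.const_mul _), hparts, integral_const_mul]
  simp only [mul_assoc, integral_const_mul]
  ring

theorem Dsub_Iws {σ μ : ℝ} (hσ : 0 < σ) (hμ : 0 ≤ μ) (hμ1 : μ < 1) {f : ℝ → ℝ}
    (hf : ContDiff ℝ 1 f) (hfi : Integrable f) (hfi' : Integrable (deriv f)) :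
    Dsub σ (Iws σ μ f) = Iws σ μ (Dsub σ f) := by
  rcases hμ.eq_or_lt with rfl | hμ
  · simp [Iws]
  rw [Iws_eq_integral_substKernel σ hμ.ne', Iws_eq_integral_substKernel σ hμ.ne']
  funext x
  have hd := (hasDerivAt_integral_substKernel_mul hσ hμ hμ1 hf hfi hfi' x).const_mul
    (1 / Real.Gamma μ)
  have hi := integrable_substKernel_mul hσ hμ hμ1 hf.continuous hfi x
  have hi' := integrable_substKernel_mul hσ hμ hμ1 (hf.continuous_deriv le_rfl) hfi' x
  have hsum : ∀ t, substKernel σ μ t * Dsub σ f (x - t) =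
      substKernel σ μ t * deriv f (x - t) + σ * (substKernel σ μ t * f (x - t)) := fun t => by
    simp only [Dsub]
    ring
  simp only [hsum]
  rw [integral_add hi' (hi.const_mul σ), integral_const_mul, Dsub, hd.deriv]
  ring

theorem contDiff_Dsub (σ : ℝ) {n : ℕ} {f : ℝ → ℝ} (hf : ContDiff ℝ ((n + 1 : ℕ) : ℕ∞) f) :
    ContDiff ℝ (n : ℕ∞) (Dsub σ f) := by
  have hf' : ContDiff ℝ ((n : ℕ∞) + 1) f := by exact_mod_cast hf
  exact (contDiff_succ_iff_deriv.1 hf').2.2.add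
    (contDiff_const.mul (hf'.of_le le_self_add))

theorem integrable_iteratedDeriv_Dsub (σ : ℝ) {n : ℕ} {f : ℝ → ℝ}
    (hf : ContDiff ℝ ((n + 1 : ℕ) : ℕ∞) f)
    (hint : ∀ k ≤ n + 1, Integrable (iteratedDeriv k f)) {k : ℕ} (hk : k ≤ n) :
    Integrable (iteratedDeriv k (Dsub σ f)) := by
  have hf' : ContDiff ℝ ((n : ℕ∞) + 1) f := by exact_mod_cast hf
  have hkn : ((k : ℕ) : WithTop ℕ∞) ≤ (n : ℕ∞) := by exact_mod_cast hk
  have hd : ContDiff ℝ k (deriv f) := (contDiff_succ_iff_deriv.1 hf').2.2.of_le hkn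
  have hc : ContDiff ℝ k fun x => σ * f x :=
    contDiff_const.mul (hf'.of_le (hkn.trans le_self_add))
  have heq : iteratedDeriv k (Dsub σ f) =
      fun x => iteratedDeriv (k + 1) f x + σ * iteratedDeriv k f x := by
    funext x
    have := iteratedDeriv_add (x := x) hd.contDiffAt hc.contDiffAt
    rw [iteratedDeriv_const_mul_field, ← iteratedDeriv_succ'] at this
    exact this
  rw [heq]
  exact (hint _ (by omega)).add ((hint _ (by omega)).const_mul σ)

theorem fourier_iterate_Dsub_Iws {σ μ : ℝ} (hσ : 0 < σ) (hμ : 0 ≤ μ) (hμ1 : μ < 1) (ω : ℝ)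
    (n : ℕ) (f : ℝ → ℝ) (hf : ContDiff ℝ (n : ℕ∞) f)
    (hint : ∀ k ≤ n, Integrable (iteratedDeriv k f)) :
    ∫ x : ℝ, Complex.exp ((ω : ℂ) * (x : ℂ) * Complex.I) * ((Dsub σ)^[n] (Iws σ μ f) x : ℂ) =
      ((σ : ℂ) - (ω : ℂ) * Complex.I) ^ n * (((σ : ℂ) - (ω : ℂ) * Complex.I) ^ (-(μ : ℂ)) *
        ∫ x : ℝ, Complex.exp ((ω : ℂ) * (x : ℂ) * Complex.I) * (f x : ℂ)) := by
  induction n generalizing f with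
  | zero =>
    have h0 : Integrable f := by simpa using hint 0 le_rfl
    simpa using fourier_Iws hσ hμ h0 ω
  | succ n ih =>
    have hf1 : ContDiff ℝ 1 f := hf.of_le (by exact_mod_cast Nat.le_add_left 1 n)
    have h0 : Integrable f := by simpa using hint 0 (by omega)
    have h1 : Integrable (deriv f) := by simpa using hint 1 (by omega)
    rw [Function.iterate_succ_apply, Dsub_Iws hσ hμ hμ1 hf1 h0 h1,
      ih _ (contDiff_Dsub σ hf) fun k hk => integrable_iteratedDeriv_Dsub σ hf hint hk,
      fourier_Dsub σ ω hf1 h0 h1]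
    ring

/-- Lemma 3.2: `ℱ(𝒟_s^ν f)(ω) = (σ−iω)^ν f̂(ω)`. -/
theorem fourier_transform_substantial_derivative
    (σ ν : ℝ) (hσ : 0 < σ) (hν : 0 < ν) (f : ℝ → ℝ)
    (hf : ContDiff ℝ ((⌈ν⌉₊ : ℕ) : ℕ∞) f)
    (hint : ∀ k ≤ ⌈ν⌉₊, MeasureTheory.Integrable (iteratedDeriv k f)) :
    ∀ ω : ℝ, (∫ x : ℝ, Complex.exp ((ω : ℂ) * (x : ℂ) * Complex.I) * (Dws σ ν f x : ℂ)) =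
      ((σ : ℂ) - (ω : ℂ) * Complex.I) ^ ((ν : ℂ)) *
        ∫ x : ℝ, Complex.exp ((ω : ℂ) * (x : ℂ) * Complex.I) * (f x : ℂ) := by
  intro ω
  have hz : (σ : ℂ) - (ω : ℂ) * Complex.I ≠ 0 := fun h => hσ.ne' <| by
    simpa using congrArg Complex.re h
  rw [Dws, fourier_iterate_Dsub_Iws hσ (sub_nonneg.2 (Nat.le_ceil ν))
    (by linarith [Nat.ceil_lt_add_one hν.le]) ω _ f hf hint, ← mul_assoc]
  congr 1
  rw [← Complex.cpow_natCast, ← Complex.cpow_add _ _ hz]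
  congr 1
  push_cast
  ring
end
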